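/- arXiv:0903.2009 — 6 statements merged into one kernel-verified Lean document; each statement's English description precedes it below -/
import Mathlib

section
/- Let ν, b, μ, A be real with ν ≠ 0 and b² = 16 μ ν; set g₂ = μ²/(12ν²) and g₃ = (13μ³ + νA)/(1080ν³). Let U ⊆ ℂ be open and P : U → ℂ three times differentiable with P'' = 6P² − g₂/2 and P'² = 4P³ − g₂ P − g₃ on U. Then u := −60ν P' − 15b P − bμ/(4ν) satisfies the KS travelling-wave ODE ν u''' + b u'' + μ u' + u²/2 + A = 0 on U. -/
/-- On the constraint `b² = 16μν`, with `g₂ = μ²/(12ν²)` and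
`g₃ = (13μ³ + νA)/(1080ν³)`, any function `P` obeying the Weierstrass equations
`P'' = 6P² - g₂/2` and `P'² = 4P³ - g₂P - g₃` on an open set `U ⊆ ℂ` yields the
elliptic solution `u = -60ν P' - 15b P - bμ/(4ν)` of the Kuramoto–Sivashinsky
travelling-wave ODE `ν u''' + b u'' + μ u' + u²/2 + A = 0` on `U`. -/
theorem ks_elliptic_solution (ν b μ A : ℝ) (hν : ν ≠ 0) (hb : b ^ 2 = 16 * μ * ν)
    (g2 g3 : ℝ) (hg2 : g2 = μ ^ 2 / (12 * ν ^ 2))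
    (hg3 : g3 = (13 * μ ^ 3 + ν * A) / (1080 * ν ^ 3))
    (U : Set ℂ) (hU : IsOpen U) (P : ℂ → ℂ)
    (h1 : ∀ z ∈ U, DifferentiableAt ℂ P z)
    (h2 : ∀ z ∈ U, DifferentiableAt ℂ (deriv P) z)
    (h3 : ∀ z ∈ U, DifferentiableAt ℂ (deriv (deriv P)) z)
    (hP2 : ∀ z ∈ U, deriv (deriv P) z = 6 * (P z) ^ 2 - (g2 : ℂ) / 2)
    (hP1 : ∀ z ∈ U, (deriv P z) ^ 2
      = 4 * (P z) ^ 3 - (g2 : ℂ) * P z - (g3 : ℂ))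
    (u : ℂ → ℂ)
    (hu : ∀ z : ℂ, u z = -60 * (ν : ℂ) * deriv P z - 15 * (b : ℂ) * P z
      - (b : ℂ) * (μ : ℂ) / (4 * (ν : ℂ))) :
    ∀ z ∈ U,
      (ν : ℂ) * deriv (deriv (deriv u)) z + (b : ℂ) * deriv (deriv u) z
      + (μ : ℂ) * deriv u z + (u z) ^ 2 / 2 + (A : ℂ) = 0 := by
  have hν' : (ν : ℂ) ≠ 0 := by exact_mod_cast hν
  have hb' : (b : ℂ) ^ 2 = 16 * μ * ν := by exact_mod_cast hb
  have hg2' : 12 * (ν : ℂ) ^ 2 * g2 = μ ^ 2 := by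
    rw [hg2]; push_cast; field_simp
  have hg3' : 1080 * (ν : ℂ) ^ 3 * g3 = 13 * μ ^ 3 + ν * A := by
    rw [hg3]; push_cast; field_simp
  have dP : ∀ z ∈ U, HasDerivAt P (deriv P z) z := fun z hz => (h1 z hz).hasDerivAt
  have dP' : ∀ z ∈ U, HasDerivAt (deriv P) (6 * P z ^ 2 - (g2 : ℂ) / 2) z := fun z hz => by
    rw [← hP2 z hz]; exact (h2 z hz).hasDerivAt
  have dPsq : ∀ z ∈ U, HasDerivAt (fun w => 6 * P w ^ 2 - (g2 : ℂ) / 2)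
      (12 * P z * deriv P z) z := fun z hz => by
    refine ((((dP z hz).pow 2).const_mul 6).sub_const ((g2 : ℂ) / 2)).congr_deriv ?_
    push_cast; ring
  have hu1 : ∀ z ∈ U, deriv u z =
      -60 * (ν : ℂ) * (6 * P z ^ 2 - (g2 : ℂ) / 2) - 15 * (b : ℂ) * deriv P z := fun z hz => by
    rw [funext hu]
    exact ((((dP' z hz).const_mul _).sub ((dP z hz).const_mul _)).sub_const _).deriv
  have hu2 : ∀ z ∈ U, deriv (deriv u) z = -60 * (ν : ℂ) * (12 * P z * deriv P z)
      - 15 * (b : ℂ) * (6 * P z ^ 2 - (g2 : ℂ) / 2) := fun z hz => by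
    rw [(Filter.eventuallyEq_of_mem (hU.mem_nhds hz) hu1).deriv_eq]
    exact (((dPsq z hz).const_mul _).sub ((dP' z hz).const_mul _)).deriv
  have hu3 : ∀ z ∈ U, deriv (deriv (deriv u)) z =
      -60 * (ν : ℂ) * (12 * deriv P z * deriv P z + 12 * P z * (6 * P z ^ 2 - (g2 : ℂ) / 2))
      - 15 * (b : ℂ) * (12 * P z * deriv P z) := fun z hz => by
    rw [(Filter.eventuallyEq_of_mem (hU.mem_nhds hz) hu2).deriv_eq]
    exact (((((dP z hz).const_mul 12).mul (dP' z hz)).const_mul _).sub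
      ((dPsq z hz).const_mul _)).deriv
  intro z hz
  have hw := hP1 z hz
  rw [hu3 z hz, hu2 z hz, hu1 z hz, hu z]
  generalize deriv P z = q at *
  generalize P z = p at *
  obtain ⟨c, hc⟩ : ∃ c : ℂ, c = b * μ / (4 * ν) := ⟨_, rfl⟩
  have hc' : 4 * (ν : ℂ) * c = b * μ := by rw [hc]; field_simp
  have hbc : (b : ℂ) * c = 4 * μ ^ 2 := by
    apply mul_left_cancel₀ hν'
    linear_combination (1 / 4) * b * hc' + (μ / 4) * hb'
  have hcc : (ν : ℂ) * c ^ 2 = μ ^ 3 := by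
    linear_combination (c / 4) * hc' + (μ / 4) * hbc
  rw [← hc]
  apply mul_left_cancel₀ hν'
  linear_combination (1080 * ν ^ 3) * hw + (15 * ν * q) * hc' + (15 * ν * p) * hbc
    + (1 / 2) * hcc + (ν * (45 / 2 * p ^ 2 + 15 / 2 * g2)) * hb'
    + (-60 * ν * p + 25 / 2 * μ) * hg2' - hg3'
end

section
/- Let ν, μ, k, ξ₀ be real with ν ≠ 0 and ν k² = 11μ/19, and set A = −4950 μ³/(19³ ν) and b = 0. Define τ(ξ) = (k/2) tanh( k(ξ−ξ₀)/2 ) and u(ξ) = 120ν τ³ − 15b τ² + (60μ/19 − 30ν k² − 15b²/(76ν)) τ + (5/2) b k² − 13 b³/(608 ν²) + 7 μ b/(76 ν). Then u satisfies the KS travelling-wave ODE ν u''' + b u'' + μ u' + u²/2 + A = 0 for all real ξ. -/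
theorem Real.hasDerivAt_tanh (x : ℝ) : HasDerivAt Real.tanh (1 - Real.tanh x ^ 2) x := by
  have hc : Real.cosh x ≠ 0 := (Real.cosh_pos x).ne'
  have h := (Real.hasDerivAt_sinh x).div (Real.hasDerivAt_cosh x) hc
  refine (h.congr_deriv ?_).congr_of_eventuallyEq (.of_forall Real.tanh_eq_sinh_div_cosh)
  rw [Real.tanh_eq_sinh_div_cosh]
  field_simp

theorem hasDerivAt_half_mul_tanh (k ξ₀ x : ℝ) :
    HasDerivAt (fun ξ ↦ k / 2 * Real.tanh (k * (ξ - ξ₀) / 2))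
      (k ^ 2 / 4 - (k / 2 * Real.tanh (k * (x - ξ₀) / 2)) ^ 2) x := by
  have hin : HasDerivAt (fun ξ : ℝ ↦ k * (ξ - ξ₀) / 2) (k / 2) x := by
    simpa using (((hasDerivAt_id x).sub_const ξ₀).const_mul k).div_const 2
  refine (((Real.hasDerivAt_tanh _).comp x hin).const_mul (k / 2)).congr_deriv ?_
  ring

open Polynomial in
/-- If `τ' = κ - τ²`, differentiation acts on polynomials in `τ` as `p ↦ p' * (κ - X²)`. -/
theorem deriv_polynomial_eval_of_riccati {τ : ℝ → ℝ} {κ : ℝ}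
    (hτ : ∀ x, HasDerivAt τ (κ - τ x ^ 2) x) (p : ℝ[X]) :
    deriv (fun x ↦ p.eval (τ x)) =
      fun x ↦ (derivative p * (C κ - X ^ 2)).eval (τ x) := by
  funext x
  have h := ((p.hasDerivAt (τ x)).comp x (hτ x)).deriv
  simpa [Function.comp_def] using h


/-- First Kuramoto–Tsuzuki trigonometric solution of KS (b = 0). The third-degree polynomial in
`τ(ξ) = (k/2) tanh(k(ξ-ξ₀)/2)` satisfies the Kuramoto–Sivashinsky
travelling-wave ODE `ν u''' + b u'' + μ u' + u²/2 + A = 0` for all real ξ. -/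
theorem ks_trig_solution_1 (ν b μ A k ξ₀ : ℝ) (hν : ν ≠ 0)
    (hk : ν * k ^ 2 = 11 * μ / 19) (hA : A = -4950 * μ ^ 3 / (19 ^ 3 * ν))
    (hb : b = 0)
    (τ : ℝ → ℝ) (hτ : ∀ ξ : ℝ, τ ξ = k / 2 * Real.tanh (k * (ξ - ξ₀) / 2))
    (u : ℝ → ℝ)
    (hu : ∀ ξ : ℝ, u ξ = 120 * ν * (τ ξ) ^ 3 - 15 * b * (τ ξ) ^ 2
      + (60 * μ / 19 - 30 * ν * k ^ 2 - 15 * b ^ 2 / (76 * ν)) * τ ξ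
      + 5 / 2 * b * k ^ 2 - 13 * b ^ 3 / (608 * ν ^ 2)
      + 7 * μ * b / (76 * ν)) :
    ∀ ξ : ℝ,
      ν * deriv (deriv (deriv u)) ξ + b * deriv (deriv u) ξ
      + μ * deriv u ξ + (u ξ) ^ 2 / 2 + A = 0 := by
  subst hb
  have hd : ∀ x, HasDerivAt τ (k ^ 2 / 4 - τ x ^ 2) x := by
    intro x
    rw [funext hτ]
    exact hasDerivAt_half_mul_tanh k ξ₀ x
  have hμ : μ = 19 * (ν * k ^ 2) / 11 := by linarith
  have hu' : u = fun x ↦ (Polynomial.C (120 * ν) * Polynomial.X ^ 3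
      + Polynomial.C (60 * μ / 19 - 30 * ν * k ^ 2) * Polynomial.X).eval (τ x) := by
    funext x
    rw [hu x]
    simp
  intro ξ
  rw [hu']
  simp only [deriv_polynomial_eval_of_riccati hd]
  rw [hA, hμ]
  simp [Polynomial.derivative_pow]
  field_simp
  ring
end

section
/- Let ν, b, μ, k, ξ₀ be real with ν ≠ 0, b² = 256 μ ν / 73 and ν k² = μ/73, and set A = −4050 μ³/(73³ ν). Define τ(ξ) = (k/2) tanh( k(ξ−ξ₀)/2 ) and u(ξ) = 120ν τ³ − 15b τ² + (60μ/19 − 30ν k² − 15b²/(76ν)) τ + (5/2) b k² − 13 b³/(608 ν²) + 7 μ b/(76 ν). Then u satisfies the KS travelling-wave ODE ν u''' + b u'' + μ u' + u²/2 + A = 0 for all real ξ. -/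
open Polynomial in
/-- Along a solution of the Riccati equation `τ' = c - τ²`, differentiating `P(τ)` amounts to
applying the derivation `P ↦ P' (c - X²)` to the polynomial `P`. -/
theorem deriv_eval_riccati {c : ℝ} {τ : ℝ → ℝ}
    (hτ : ∀ x, HasDerivAt τ (c - τ x ^ 2) x) (P : ℝ[X]) :
    deriv (fun x => P.eval (τ x)) = fun x => (derivative P * (C c - X ^ 2)).eval (τ x) := by
  funext x
  rw [HasDerivAt.deriv (f := fun x => P.eval (τ x)) ((P.hasDerivAt (τ x)).comp x (hτ x))]
  simp

theorem hasDerivAt_tanh_riccati (k ξ₀ x : ℝ) :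
    HasDerivAt (fun ξ => k / 2 * Real.tanh (k * (ξ - ξ₀) / 2))
      (k ^ 2 / 4 - (k / 2 * Real.tanh (k * (x - ξ₀) / 2)) ^ 2) x := by
  have hlin : HasDerivAt (fun ξ => k * (ξ - ξ₀) / 2) (k / 2) x := by
    simpa using (((hasDerivAt_id x).sub_const ξ₀).const_mul k).div_const 2
  refine (((Real.hasDerivAt_tanh _).comp x hlin).const_mul (k / 2)).congr_deriv ?_
  ring

open Polynomial in
/-- If `b = 16 ν k` and `τ' = k²/4 - τ²`, the cubic `ν (120 τ³ - 240 k τ² + 150 k² τ + 60 k³)`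
solves the travelling-wave equation with `μ = 73 ν k²`. The sign of `k` is free. -/
theorem ks_ode_of_riccati {ν k : ℝ} {τ u : ℝ → ℝ}
    (hτ : ∀ x, HasDerivAt τ (k ^ 2 / 4 - τ x ^ 2) x)
    (hu : ∀ x, u x = ν * (120 * τ x ^ 3 - 240 * k * τ x ^ 2 + 150 * k ^ 2 * τ x + 60 * k ^ 3))
    (x : ℝ) :
    ν * deriv (deriv (deriv u)) x + 16 * ν * k * deriv (deriv u) x
      + 73 * ν * k ^ 2 * deriv u x + u x ^ 2 / 2 - 4050 * ν ^ 2 * k ^ 6 = 0 := by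
  have hP : u = fun x => (C ν * (C 120 * X ^ 3 - C (240 * k) * X ^ 2
      + C (150 * k ^ 2) * X + C (60 * k ^ 3))).eval (τ x) := by
    funext x
    simp only [hu, eval_mul, eval_add, eval_sub, eval_pow, eval_C, eval_X]
  rw [hP]
  simp only [deriv_eval_riccati hτ]
  simp only [derivative_mul, derivative_add, derivative_sub,
    derivative_C, derivative_X, derivative_X_pow, eval_mul,
    eval_add, eval_sub, eval_pow, eval_C, eval_X, eval_zero, eval_one]
  norm_num
  ring

/-- Kudryashov's trigonometric solution of KS with b²/(μν) = 256/73. The third-degree polynomial in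
`τ(ξ) = (k/2) tanh(k(ξ-ξ₀)/2)` satisfies the Kuramoto–Sivashinsky
travelling-wave ODE `ν u''' + b u'' + μ u' + u²/2 + A = 0` for all real ξ. -/
theorem ks_trig_solution_4 (ν b μ A k ξ₀ : ℝ) (hν : ν ≠ 0)
    (hb : b ^ 2 = 256 * μ * ν / 73) (hk : ν * k ^ 2 = μ / 73)
    (hA : A = -4050 * μ ^ 3 / (73 ^ 3 * ν))
    (τ : ℝ → ℝ) (hτ : ∀ ξ : ℝ, τ ξ = k / 2 * Real.tanh (k * (ξ - ξ₀) / 2))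
    (u : ℝ → ℝ)
    (hu : ∀ ξ : ℝ, u ξ = 120 * ν * (τ ξ) ^ 3 - 15 * b * (τ ξ) ^ 2
      + (60 * μ / 19 - 30 * ν * k ^ 2 - 15 * b ^ 2 / (76 * ν)) * τ ξ
      + 5 / 2 * b * k ^ 2 - 13 * b ^ 3 / (608 * ν ^ 2)
      + 7 * μ * b / (76 * ν)) :
    ∀ ξ : ℝ,
      ν * deriv (deriv (deriv u)) ξ + b * deriv (deriv u) ξ
      + μ * deriv u ξ + (u ξ) ^ 2 / 2 + A = 0 := by
  obtain rfl : μ = 73 * ν * k ^ 2 := by linarith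
  have hτ' : ∀ x, HasDerivAt τ (k ^ 2 / 4 - τ x ^ 2) x := by
    rw [funext hτ]
    exact hasDerivAt_tanh_riccati k ξ₀
  have hfac : (b - 16 * ν * k) * (b + 16 * ν * k) = 0 := by linear_combination hb
  intro ξ
  rcases mul_eq_zero.mp hfac with h | h
  · obtain rfl : b = 16 * ν * k := by linarith
    have key := ks_ode_of_riccati (ν := ν) hτ' (u := u) (fun x => by
      rw [hu]
      field_simp
      ring) ξ
    rw [← key, hA]
    field_simp
    ring
  · obtain rfl : b = 16 * ν * (-k) := by linarith
    have key := ks_ode_of_riccati (ν := ν) (k := -k) (by simpa using hτ') (u := u) (fun x => by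
      rw [hu]
      field_simp
      ring) ξ
    rw [← key, hA]
    field_simp
    ring
end

section
/- Let ε = 1 or ε = −1. For every real x with (x³ + 4)(x⁶ + 20x³ − 80) ≠ 0, the function u(x) = −ε · 3x²(x⁶ + 8x³ + 160)/( (x³ + 4)(x⁶ + 20x³ − 80) ) satisfies the second Painlevé equation u'' = 2u³ + x u + α with α = 3ε. -/
/-- The second derivative of a quotient `N / D` at a point where `D` does not vanish. -/
theorem deriv_deriv_eq_of_eq_div {u N D N' D' N'' D'' : ℝ → ℝ}
    (hN : ∀ x, HasDerivAt N (N' x) x) (hD : ∀ x, HasDerivAt D (D' x) x)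
    (hN' : ∀ x, HasDerivAt N' (N'' x) x) (hD' : ∀ x, HasDerivAt D' (D'' x) x)
    (hu : ∀ x, D x ≠ 0 → u x = N x / D x) {x : ℝ} (hx : D x ≠ 0) :
    deriv (deriv u) x =
      ((N'' x * D x - N x * D'' x) * D x - 2 * D' x * (N' x * D x - N x * D' x)) / D x ^ 3 := by
  have hev : ∀ y, D y ≠ 0 → ∀ᶠ z in nhds y, D z ≠ 0 := fun y hy =>
    (hD y).continuousAt.eventually_ne hy
  have h1 : ∀ y, D y ≠ 0 → deriv u y = (N' y * D y - N y * D' y) / D y ^ 2 := by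
    intro y hy
    have he : u =ᶠ[nhds y] fun z => N z / D z := (hev y hy).mono hu
    rw [he.deriv_eq]
    exact ((hN y).div (hD y) hy).deriv
  have he : deriv u =ᶠ[nhds x] fun z => (N' z * D z - N z * D' z) / D z ^ 2 := (hev x hx).mono h1
  rw [he.deriv_eq]
  have h2 := ((((hN' x).mul (hD x)).sub ((hN x).mul (hD' x))).div ((hD x).pow 2)
    (pow_ne_zero 2 hx)).deriv
  refine h2.trans ?_
  simp only [Pi.mul_apply, Pi.sub_apply, Pi.pow_apply]
  field_simp
  ring


/-- For `ε = ±1`, the function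
`u(x) = -ε·3x²(x⁶+8x³+160)/((x³+4)(x⁶+20x³-80))` satisfies the second Painlevé
equation `u'' = 2u³ + xu + α` with `α = 3ε`, for every real `x` with
`(x³+4)(x⁶+20x³-80) ≠ 0`. -/
theorem painleve2_rational_alpha3 (ε : ℝ) (hε : ε = 1 ∨ ε = -1) (u : ℝ → ℝ)
    (hu : ∀ x : ℝ, (x ^ 3 + 4) * (x ^ 6 + 20 * x ^ 3 - 80) ≠ 0 →
      u x = -ε * (3 * x ^ 2 * (x ^ 6 + 8 * x ^ 3 + 160))
        / ((x ^ 3 + 4) * (x ^ 6 + 20 * x ^ 3 - 80))) :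
    ∀ x : ℝ, (x ^ 3 + 4) * (x ^ 6 + 20 * x ^ 3 - 80) ≠ 0 →
      deriv (deriv u) x = 2 * (u x) ^ 3 + x * u x + 3 * ε := by
  intro x hx
  have key := deriv_deriv_eq_of_eq_div (u := u)
    (N := fun x => -ε * (3 * x ^ 2 * (x ^ 6 + 8 * x ^ 3 + 160)))
    (D := fun x => (x ^ 3 + 4) * (x ^ 6 + 20 * x ^ 3 - 80))
    (N' := fun x => -ε * (24 * x ^ 7 + 120 * x ^ 4 + 960 * x))
    (D' := fun x => 9 * x ^ 8 + 144 * x ^ 5)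
    (N'' := fun x => -ε * (168 * x ^ 6 + 480 * x ^ 3 + 960))
    (D'' := fun x => 72 * x ^ 7 + 720 * x ^ 4)
    (fun x => by
      refine HasDerivAt.congr_deriv (((((hasDerivAt_id' x).pow 2).const_mul 3).mul
        ((((hasDerivAt_id' x).pow 6).add (((hasDerivAt_id' x).pow 3).const_mul 8)).add_const
          160)).const_mul (-ε)) ?_
      simp [-mul_eq_mul_left_iff]
      ring)
    (fun x => by
      refine HasDerivAt.congr_deriv ((((hasDerivAt_id' x).pow 3).add_const 4).mul
        ((((hasDerivAt_id' x).pow 6).add (((hasDerivAt_id' x).pow 3).const_mul 20)).sub_const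
          80)) ?_
      simp [-mul_eq_mul_left_iff]
      ring)
    (fun x => by
      refine HasDerivAt.congr_deriv ((((((hasDerivAt_id' x).pow 7).const_mul 24).add
        (((hasDerivAt_id' x).pow 4).const_mul 120)).add
          ((hasDerivAt_id' x).const_mul 960)).const_mul (-ε)) ?_
      simp [-mul_eq_mul_left_iff]
      ring)
    (fun x => by
      refine HasDerivAt.congr_deriv ((((hasDerivAt_id' x).pow 8).const_mul 9).add
        (((hasDerivAt_id' x).pow 5).const_mul 144)) ?_
      simp [-mul_eq_mul_left_iff]
      ring)
    hu hx
  rw [key, hu x hx]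
  have hε3 : ε ^ 3 = ε := by rcases hε with rfl | rfl <;> norm_num
  have clear_denom : ∀ n d : ℝ, d ≠ 0 →
      (2 * (n / d) ^ 3 + x * (n / d) + 3 * ε) * d ^ 3 =
        2 * n ^ 3 + x * n * d ^ 2 + 3 * ε * d ^ 3 := by
    intro n d hd
    field_simp
  rw [div_eq_iff (pow_ne_zero 3 hx), clear_denom _ _ hx]
  linear_combination 2 * (3 * x ^ 2 * (x ^ 6 + 8 * x ^ 3 + 160)) ^ 3 * hε3
end

section
/- Let e_i, g_r, g₂, c₀ be complex numbers with e_i ≠ 0, c₀² = 4g_r/(3e_i) and g₂ = −g_r²/27. Let U ⊆ ℂ be open and P : U → ℂ differentiable with P'(ξ)² = 4P(ξ)³ − g₂ P(ξ) and 4P(ξ)² + g₂ ≠ 0 on U. Then the function M := c₀ (4P² − g₂)/(4P² + g₂) satisfies the quartic first-order subequation 81 · e_i · M'⁴ − M² · (3 e_i M² − 4 g_r)³ = 0 on U. -/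
/-- For the CGL5 travelling wave, with `e_i ≠ 0`,
`c₀² = 4g_r/(3e_i)`, `g₂ = -g_r²/27`, and `P` a differentiable function on an
open set `U ⊆ ℂ` obeying `P'² = 4P³ - g₂P` with `4P² + g₂ ≠ 0`, the squared
modulus `M = c₀(4P² - g₂)/(4P² + g₂)` satisfies the quartic first-order
subequation `81 e_i M'⁴ - M²(3e_i M² - 4g_r)³ = 0` on `U`. -/
theorem cgl5_modulus_subequation (ei gr g2 c0 : ℂ) (hei : ei ≠ 0)
    (hc0 : c0 ^ 2 = 4 * gr / (3 * ei)) (hg2 : g2 = -gr ^ 2 / 27)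
    (U : Set ℂ) (hU : IsOpen U) (P : ℂ → ℂ)
    (hdiff : ∀ z ∈ U, DifferentiableAt ℂ P z)
    (hP : ∀ z ∈ U, (deriv P z) ^ 2 = 4 * (P z) ^ 3 - g2 * P z)
    (hne : ∀ z ∈ U, 4 * (P z) ^ 2 + g2 ≠ 0)
    (M : ℂ → ℂ)
    (hM : ∀ z : ℂ, M z = c0 * (4 * (P z) ^ 2 - g2) / (4 * (P z) ^ 2 + g2)) :
    ∀ z ∈ U,
      81 * ei * (deriv M z) ^ 4
        - (M z) ^ 2 * (3 * ei * (M z) ^ 2 - 4 * gr) ^ 3 = 0 := by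
  intro z hz
  have hD := hne z hz
  have hp := hP z hz
  have hgr : gr = 3 * ei * c0 ^ 2 / 4 := by
    rw [hc0]
    field_simp
  have hsq := (hdiff z hz).hasDerivAt.pow 2
  have hM' : HasDerivAt M (c0 * (16 * g2 * P z * deriv P z) / (4 * P z ^ 2 + g2) ^ 2) z := by
    rw [funext hM]
    refine ((((hsq.const_mul 4).sub_const g2).const_mul c0).div
      ((hsq.const_mul 4).add_const g2) hD).congr_deriv ?_
    simp only [Pi.pow_apply]
    push_cast
    ring
  have hp4 : deriv P z ^ 4 = (4 * P z ^ 3 - g2 * P z) ^ 2 := by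
    rw [← hp]
    ring
  rw [hM'.deriv, hM z, div_pow]
  have hpow : (c0 * (16 * g2 * P z * deriv P z)) ^ 4 =
      c0 ^ 4 * (16 * g2 * P z) ^ 4 * (4 * P z ^ 3 - g2 * P z) ^ 2 := by
    rw [← hp4]
    ring
  have hfactor : 3 * ei * (c0 * (4 * P z ^ 2 - g2) / (4 * P z ^ 2 + g2)) ^ 2 - 4 * gr =
      -(48 * ei * c0 ^ 2 * g2 * P z ^ 2) / (4 * P z ^ 2 + g2) ^ 2 := by
    rw [hgr]
    field_simp
    ring
  have hcoeff : 48 * g2 = -(ei ^ 2 * c0 ^ 4) := by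
    rw [hg2, hgr]
    ring
  rw [hpow, hfactor]
  generalize 4 * P z ^ 2 + g2 = D
  linear_combination 110592 * ei * c0 ^ 4 * g2 ^ 3 * P z ^ 6 * (4 * P z ^ 2 - g2) ^ 2 /
    D ^ 8 * hcoeff
end

section
/- Let g_r ≠ 0 be a complex number and g₂ = −g_r²/27. Let U ⊆ ℂ be open, Q : U → ℂ differentiable and nonvanishing with Q'(ξ)² = 16 Q(ξ)³ − 4 g₂ Q(ξ) on U, and let ψ : U → ℂ be differentiable with ψ(ξ)² = −3g₂/(4Q(ξ)) on U. Then ψ satisfies the Jacobi-type first-order subequation 9 ψ'² − 12 ψ⁴ − g_r² = 0 on U. -/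
/-- For the CGL5 travelling wave, with `g_r ≠ 0`, `g₂ = -g_r²/27`,
`Q` differentiable and nonvanishing on an open set `U ⊆ ℂ` with
`Q'² = 16Q³ - 4g₂Q` (i.e. `Q(ξ) = ℘(2ξ)` with `g₃ = 0`), any differentiable `ψ`
with `ψ² = -3g₂/(4Q)` satisfies the Jacobi-type subequation
`9ψ'² - 12ψ⁴ - g_r² = 0` on `U`. -/
theorem cgl5_phase_subequation (gr g2 : ℂ) (hgr : gr ≠ 0)
    (hg2 : g2 = -gr ^ 2 / 27)
    (U : Set ℂ) (hU : IsOpen U) (Q ψ : ℂ → ℂ)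
    (hQdiff : ∀ z ∈ U, DifferentiableAt ℂ Q z)
    (hQne : ∀ z ∈ U, Q z ≠ 0)
    (hQ : ∀ z ∈ U, (deriv Q z) ^ 2 = 16 * (Q z) ^ 3 - 4 * g2 * Q z)
    (hψdiff : ∀ z ∈ U, DifferentiableAt ℂ ψ z)
    (hψ : ∀ z ∈ U, (ψ z) ^ 2 = -3 * g2 / (4 * Q z)) :
    ∀ z ∈ U, 9 * (deriv ψ z) ^ 2 - 12 * (ψ z) ^ 4 - gr ^ 2 = 0 := by
  intro z hz
  have hQz := hQne z hz
  have hg2ne : g2 ≠ 0 := by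
    rw [hg2]
    exact div_ne_zero (neg_ne_zero.mpr (pow_ne_zero 2 hgr)) (by norm_num)
  have hprod : ∀ w ∈ U, ψ w ^ 2 * Q w = -3 * g2 / 4 := by
    intro w hw
    have hQw := hQne w hw
    rw [hψ w hw]
    field_simp
  have hψz : ψ z ≠ 0 := by
    intro h
    have hzero := hprod z hz
    rw [h] at hzero
    apply hg2ne
    linear_combination (4 / 3 : ℂ) * hzero
  have hderiv : HasDerivAt (fun w => ψ w ^ 2 * Q w)
      (2 * ψ z * deriv ψ z * Q z + ψ z ^ 2 * deriv Q z) z := by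
    simpa using ((hψdiff z hz).hasDerivAt.fun_pow 2).fun_mul (hQdiff z hz).hasDerivAt
  have hconst : HasDerivAt (fun w => ψ w ^ 2 * Q w) 0 z :=
    (hasDerivAt_const z (-3 * g2 / 4)).congr_of_eventuallyEq
      (Filter.eventuallyEq_of_mem (hU.mem_nhds hz) hprod)
  have hlog : 2 * deriv ψ z * Q z = -(ψ z * deriv Q z) := by
    apply mul_left_cancel₀ hψz
    linear_combination hderiv.unique hconst
  have hsq : 4 * deriv ψ z ^ 2 * Q z ^ 2 = ψ z ^ 2 * (16 * Q z ^ 3 - 4 * g2 * Q z) := by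
    rw [← hQ z hz]
    linear_combination (2 * deriv ψ z * Q z - ψ z * deriv Q z) * hlog
  have hgr2 : gr ^ 2 = -27 * g2 := by
    rw [hg2]
    ring
  apply mul_left_cancel₀ (pow_ne_zero 2 hQz)
  linear_combination (9 / 4 : ℂ) * hsq - Q z ^ 2 * hgr2 +
    (36 * Q z ^ 2 - 9 * g2 - 12 * (ψ z ^ 2 * Q z - 3 * g2 / 4)) * hprod z hz
end
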